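/- Let G be a minimal counterexample. Then G contains no 3-vertex in U that is incident to three 1-threads all of whose bordering vertices lie in F ∪ U. -/

import Mathlib

open SimpleGraph

noncomputable def edgeCount {V : Type*} (G : SimpleGraph V) : ℕ := Nat.card G.edgeSet

noncomputable def deg {V : Type*} (G : SimpleGraph V) (v : V) : ℕ := Nat.card (G.neighborSet v)

def TwoIndependent {V : Type*} (G : SimpleGraph V) (S : Set V) : Prop :=
  ∀ u ∈ S, ∀ v ∈ S, u ≠ v → ¬ G.Adj u v ∧ ∀ w, ¬ (G.Adj u w ∧ G.Adj w v)

def IsIFPartition {V : Type*} (G : SimpleGraph V) (A B : Set V) : Prop :=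
  A ∪ B = Set.univ ∧ Disjoint A B ∧ TwoIndependent G A ∧ (G.induce B).IsAcyclic

def IsAssignment {V : Type*} (I F U : Set V) : Prop :=
  I ∪ F ∪ U = Set.univ ∧ Disjoint I F ∧ Disjoint I U ∧ Disjoint F U

noncomputable def rho {V : Type*} (G : SimpleGraph V) (I F U : Set V) (H : G.Subgraph) : ℤ :=
  (H.verts ∩ I).ncard + 4 * (H.verts ∩ F).ncard + 5 * (H.verts ∩ U).ncard
    - 4 * Nat.card H.edgeSet

noncomputable def rhoSet {V : Type*} (G : SimpleGraph V) (I F U : Set V) (S : Set V) : ℤ :=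
  (S ∩ I).ncard + 4 * (S ∩ F).ncard + 5 * (S ∩ U).ncard - 4 * edgeCount (G.induce S)

def IsCounterexample {V : Type*} [Fintype V] (G : SimpleGraph V) (I F U : Set V) : Prop :=
  IsAssignment I F U ∧
  (∀ H : G.Subgraph, H.verts.Nonempty → 0 < rho G I F U H) ∧
  ¬ ∃ A B : Set V, IsIFPartition G A B ∧ I ⊆ A ∧ F ⊆ B

def IsMinCounterexample {V : Type*} [Fintype V] (G : SimpleGraph V) (I F U : Set V) : Prop :=
  IsCounterexample G I F U ∧
  ∀ (n : ℕ) (G' : SimpleGraph (Fin n)) (I' F' U' : Set (Fin n)),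
    IsCounterexample G' I' F' U' →
    Fintype.card V + edgeCount G ≤ n + edgeCount G'

def IsThread {V : Type*} (G : SimpleGraph V) (I F U : Set V) (p : List V) : Prop :=
  p ≠ [] ∧ p.Nodup ∧ p.Chain' G.Adj ∧ (∀ v ∈ p, v ∈ U ∧ deg G v = 2) ∧
  (∀ w, w ∉ p → (∃ a ∈ p, G.Adj a w) → 3 ≤ deg G w ∨ w ∈ I ∪ F)

def BordersThread {V : Type*} (G : SimpleGraph V) (p : List V) (w : V) : Prop :=
  w ∉ p ∧ ∃ a ∈ p, G.Adj a w

def IsStarForest {V : Type*} (H : SimpleGraph V) : Prop :=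
  H.IsAcyclic ∧ ∀ a b c d : V, H.Adj a b → H.Adj b c → H.Adj c d → a = c ∨ b = d

def IsStarColoring {V : Type*} {k : ℕ} (G : SimpleGraph V) (c : V → Fin k) : Prop :=
  (∀ u v, G.Adj u v → c u ≠ c v) ∧
  ∀ i j : Fin k, IsStarForest (G.induce {v | c v = i ∨ c v = j})

def StarColorable {V : Type*} (G : SimpleGraph V) (k : ℕ) : Prop :=
  ∃ c : V → Fin k, IsStarColoring G c

def MadLt {V : Type*} (G : SimpleGraph V) (q : ℚ) : Prop :=
  ∀ H : G.Subgraph, H.verts.Nonempty →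
    (2 * (Nat.card H.edgeSet : ℚ)) / (H.verts.ncard : ℚ) < q


namespace IFP
open Classical

/-- ordered edge count between two finite sets -/
noncomputable def ec {V : Type*} (G : SimpleGraph V) (X Y : Finset V) : ℤ :=
  ∑ x ∈ X, ∑ y ∈ Y, if G.Adj x y then 1 else 0

noncomputable def wt {V : Type*} (I F : Set V) (x : V) : ℤ :=
  if x ∈ I then 1 else if x ∈ F then 4 else 5

/-- twice the potential of the subgraph induced by a finite set -/
noncomputable def pot {V : Type*} (G : SimpleGraph V) (I F : Set V) (X : Finset V) : ℤ :=
  2 * ∑ x ∈ X, wt I F x - 4 * ec G X X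

lemma ec_comm {V : Type*} (G : SimpleGraph V) (X Y : Finset V) : ec G X Y = ec G Y X := by
  unfold ec
  rw [Finset.sum_comm]
  simp only [G.adj_comm]

lemma ec_union_left {V : Type*} (G : SimpleGraph V) {X Y : Finset V} (Z : Finset V)
    (h : Disjoint X Y) : ec G (X ∪ Y) Z = ec G X Z + ec G Y Z := by
  unfold ec
  rw [Finset.sum_union h]

lemma ec_union {V : Type*} (G : SimpleGraph V) {X Y : Finset V}
    (h : Disjoint X Y) : ec G (X ∪ Y) (X ∪ Y) = ec G X X + ec G Y Y + 2 * ec G X Y := by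
  rw [ec_union_left _ _ h, ec_comm, ec_union_left _ _ h, ec_comm G Y (X ∪ Y),
    ec_union_left _ _ h, ec_comm G Y X]
  ring

lemma ec_nonneg {V : Type*} (G : SimpleGraph V) (X Y : Finset V) : 0 ≤ ec G X Y :=
  Finset.sum_nonneg fun _ _ => Finset.sum_nonneg fun _ _ => by split_ifs <;> simp

lemma ec_mono {V : Type*} (G : SimpleGraph V) {X Y X' Y' : Finset V} (hX : X ⊆ X') (hY : Y ⊆ Y') :
    ec G X Y ≤ ec G X' Y' := by
  unfold ec
  calc _ ≤ ∑ x ∈ X, ∑ y ∈ Y', (if G.Adj x y then 1 else 0 : ℤ) :=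
        Finset.sum_le_sum fun _ _ => Finset.sum_le_sum_of_subset_of_nonneg hY
          fun _ _ _ => by split_ifs <;> simp
    _ ≤ _ := Finset.sum_le_sum_of_subset_of_nonneg hX
          fun _ _ _ => Finset.sum_nonneg fun _ _ => by split_ifs <;> simp

lemma ec_single_self {V : Type*} (G : SimpleGraph V) (x : V) : ec G {x} {x} = 0 := by
  simp [ec]

lemma ec_one {V : Type*} (G : SimpleGraph V) {x y : V} {X : Finset V} (hy : y ∈ X)
    (h : G.Adj x y) : 1 ≤ ec G {x} X := by
  have : ec G {x} {y} ≤ ec G {x} X := ec_mono G (by simp) (by simpa using hy)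
  have h2 : ec G {x} {y} = 1 := by simp only [ec, Finset.sum_singleton, h, if_true]
  omega

lemma ec_two {V : Type*} (G : SimpleGraph V) {x y z : V} {X : Finset V} (hy : y ∈ X) (hz : z ∈ X)
    (hyz : y ≠ z) (h : G.Adj x y) (h' : G.Adj x z) : 2 ≤ ec G {x} X := by
  have : ec G {x} {y, z} ≤ ec G {x} X := ec_mono G (by simp) (by grind)
  have h2 : ec G {x} {y, z} = 2 := by
    simp [ec, Finset.sum_pair hyz, h, h']
  omega

lemma ec_three {V : Type*} (G : SimpleGraph V) {x y z w : V} {X : Finset V} (hy : y ∈ X)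
    (hz : z ∈ X) (hw : w ∈ X)
    (hyz : y ≠ z) (hyw : y ≠ w) (hzw : z ≠ w)
    (h : G.Adj x y) (h' : G.Adj x z) (h'' : G.Adj x w) : 3 ≤ ec G {x} X := by
  have : ec G {x} {y, z, w} ≤ ec G {x} X := ec_mono G (by simp) (by grind)
  have h2 : ec G {x} {y, z, w} = 3 := by
    have : y ∉ ({z, w} : Finset V) := by grind
    simp only [ec, Finset.sum_singleton]
    rw [Finset.sum_insert this, Finset.sum_pair hzw]
    simp [h, h', h'']
  omega

lemma pot_union {V : Type*} (G : SimpleGraph V) (I F : Set V) {X Y : Finset V}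
    (h : Disjoint X Y) : pot G I F (X ∪ Y) = pot G I F X + pot G I F Y - 8 * ec G X Y := by
  unfold pot
  rw [ec_union G h, Finset.sum_union h]
  ring

lemma pot_insert {V : Type*} (G : SimpleGraph V) (I F : Set V) {X : Finset V} {x : V}
    (h : x ∉ X) : pot G I F (insert x X) = pot G I F X + 2 * wt I F x - 8 * ec G {x} X := by
  rw [Finset.insert_eq, pot_union G I F (by simpa using h)]
  have : pot G I F {x} = 2 * wt I F x := by simp [pot, ec_single_self]
  rw [this]; ring

/-- handshake -/
lemma ec_univ {V : Type*} [Fintype V] (K : SimpleGraph V) :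
    ec K Finset.univ Finset.univ = 2 * (Nat.card K.edgeSet : ℤ) := by
  have h := K.sum_degrees_eq_twice_card_edges
  rw [Nat.card_eq_fintype_card, ← edgeFinset_card]
  have h2 : ∀ v, ((K.degree v : ℕ) : ℤ) = ∑ y, if K.Adj v y then 1 else 0 := by
    intro v
    rw [← card_neighborFinset_eq_degree, neighborFinset_eq_filter]
    simp
  unfold ec
  simp only [← h2]
  exact_mod_cast h

lemma sum_wt {V : Type*} [Fintype V] {I F U : Set V} (h : IsAssignment I F U) (X : Finset V) :
    ∑ x ∈ X, wt I F x = (((X : Set V) ∩ I).ncard : ℤ) + 4 * ((X : Set V) ∩ F).ncard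
      + 5 * ((X : Set V) ∩ U).ncard := by
  obtain ⟨h1, h2, h3, h4⟩ := h
  have key : ∀ S : Set V, (((X : Set V) ∩ S).ncard : ℤ) = ∑ x ∈ X, if x ∈ S then 1 else 0 := by
    intro S
    have : (X : Set V) ∩ S = ((X.filter (· ∈ S) : Finset V) : Set V) := by ext; simp
    rw [this, Set.ncard_coe_finset]
    simp
  rw [key, key, key, Finset.mul_sum, Finset.mul_sum, ← Finset.sum_add_distrib,
    ← Finset.sum_add_distrib]
  refine Finset.sum_congr rfl fun x _ => ?_
  have hx : x ∈ I ∪ F ∪ U := h1 ▸ Set.mem_univ x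
  rw [Set.disjoint_left] at h2 h3 h4
  have := @h2 x
  have := @h3 x
  have := @h4 x
  unfold wt
  rcases hx with (hx | hx) | hx <;> simp_all
  · have : x ∉ I := fun h => by simp_all
    simp [this]
  · have : x ∉ I := fun h => by simp_all
    have : x ∉ F := fun h => by simp_all
    simp_all

lemma pot_iff {V : Type*} [Fintype V] {G : SimpleGraph V} {I F U : Set V}
    (h : IsAssignment I F U) :
    (∀ H : G.Subgraph, H.verts.Nonempty → 0 < rho G I F U H) ↔
      ∀ X : Finset V, X.Nonempty → 0 < pot G I F X := by
  have hsp : ∀ H : G.Subgraph, (2 * Nat.card H.edgeSet : ℤ) = ∑ x, ∑ y, if H.Adj x y then 1 else 0 := by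
    intro H
    rw [← Subgraph.edgeSet_spanningCoe, ← ec_univ]
    rfl
  constructor
  · intro hr X hX
    have hH := hr ((⊤ : G.Subgraph).induce X) (by simpa using hX)
    unfold rho at hH
    simp only [Subgraph.induce_verts] at hH
    rw [← sum_wt h] at hH
    have h2 := hsp ((⊤ : G.Subgraph).induce X)
    have h3 : ec G X X = ∑ x, ∑ y, if ((⊤ : G.Subgraph).induce X).Adj x y then (1 : ℤ) else 0 := by
      unfold ec
      rw [← Finset.sum_subset (Finset.subset_univ X)]
      · refine Finset.sum_congr rfl fun x hx => ?_
        rw [← Finset.sum_subset (Finset.subset_univ X)]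
        · refine Finset.sum_congr rfl fun y hy => ?_
          simp [hx, hy]
        · intro y _ hy
          simp [hy]
      · intro x _ hx
        simp [hx]
    unfold pot
    have h4 : ec G X X = 2 * (Nat.card ((⊤ : G.Subgraph).induce X).edgeSet : ℤ) := by
      rw [h3]; convert h2.symm
    rw [h4]
    linarith
  · intro hp H hH
    have hX := hp H.verts.toFinset (by simpa using hH)
    unfold pot at hX
    rw [sum_wt h] at hX
    simp only [Set.coe_toFinset] at hX
    have h2 := hsp H
    have h3 : (∑ x, ∑ y, if H.Adj x y then (1 : ℤ) else 0) ≤ ec G H.verts.toFinset H.verts.toFinset := by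
      unfold ec
      rw [← Finset.sum_subset (Finset.subset_univ H.verts.toFinset)]
      · refine Finset.sum_le_sum fun x hx => ?_
        rw [← Finset.sum_subset (Finset.subset_univ H.verts.toFinset)]
        · refine Finset.sum_le_sum fun y hy => ?_
          by_cases hxy : H.Adj x y
          · simp [hxy, hxy.adj_sub]
          · simp only [hxy, if_false]; split_ifs <;> simp
        · intro y _ hy
          have : ¬ H.Adj x y := fun h => hy (by simpa using h.snd_mem)
          simp [this]
      · intro x _ hx
        have : ∀ y, ¬ H.Adj x y := fun y h => hx (by simpa using h.fst_mem)
        simp [this]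
    unfold rho
    linarith

lemma ec_map {V W : Type*} (G : SimpleGraph V) (f : W ↪ V) (X Y : Finset W) :
    ec G (X.map f) (Y.map f) = ec (G.comap f) X Y := by
  simp only [ec, Finset.sum_map, comap_adj]

lemma acyclic_ec {V : Type*} [Fintype V] [Nonempty V] {K : SimpleGraph V} (h : K.IsAcyclic) :
    ec K Finset.univ Finset.univ + 2 ≤ 2 * Fintype.card V := by
  obtain ⟨T, hT, hmax⟩ := exists_maximal_isAcyclic_of_le_isAcyclic (le_top (a := K)) h
  have hm : Maximal IsAcyclic T := by
    simpa using hmax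
  have ht := (maximal_isAcyclic_iff_isTree.mp hm).card_edgeFinset
  have hle : ec K Finset.univ Finset.univ ≤ ec T Finset.univ Finset.univ := by
    unfold ec
    refine Finset.sum_le_sum fun x _ => Finset.sum_le_sum fun y _ => ?_
    by_cases hxy : K.Adj x y
    · simp [hxy, hT hxy]
    · simp only [hxy, if_false]; split_ifs <;> simp
  rw [ec_univ T, Nat.card_eq_fintype_card, ← edgeFinset_card] at hle
  omega

lemma acyclic_iff {V : Type*} [Fintype V] (G : SimpleGraph V) (B : Set V) :
    (G.induce B).IsAcyclic ↔ ∀ X : Finset V, X.Nonempty → (∀ x ∈ X, x ∈ B) →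
      ec G X X + 2 ≤ 2 * (X.card : ℤ) := by
  constructor
  · intro h X hX hB
    have : (G.induce (X : Set V)).IsAcyclic :=
      h.comap (SimpleGraph.induceHomOfLE G (fun x hx => hB x hx)).toHom
        (SimpleGraph.induceHomOfLE G (fun x hx => hB x hx)).injective
    have hne : Nonempty (X : Set V) := hX.to_subtype
    have h2 := acyclic_ec this
    have h3 := ec_map G (Function.Embedding.subtype (· ∈ (X : Set V))) Finset.univ Finset.univ
    have h4 : Finset.univ.map (Function.Embedding.subtype (· ∈ (X : Set V))) = X := by
      ext; simp
    rw [h4] at h3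
    rw [h3]
    have h5 : Fintype.card (X : Set V) = X.card := by simp
    rw [h5] at h2
    exact h2
  · intro h u p hp
    let S : Finset B := p.support.toFinset
    let X : Finset V := S.map (Function.Embedding.subtype _)
    have h1 := h X (by simp [X, S]) (by simp only [X, Finset.mem_map]; rintro x ⟨y, _, rfl⟩; exact y.2)
    have h3 : ec G X X = ec (G.induce B) S S := ec_map G (Function.Embedding.subtype (· ∈ B)) S S
    have h4 : X.card = S.card := Finset.card_map _
    have h5 : ∀ x ∈ S, (2 : ℤ) ≤ ∑ y ∈ S, if (G.induce B).Adj x y then 1 else 0 := by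
      intro x hx
      have hx' : x ∈ p.support := by simpa [S] using hx
      have := hp.ncard_neighborSet_toSubgraph_eq_two hx'
      obtain ⟨y, z, hyz, he⟩ := Set.ncard_eq_two.mp this
      have hy : p.toSubgraph.Adj x y := by
        change y ∈ p.toSubgraph.neighborSet x
        simp [he]
      have hz : p.toSubgraph.Adj x z := by
        change z ∈ p.toSubgraph.neighborSet x
        simp [he]
      have := ec_two (G.induce B) (X := S) (x := x)
        (by simpa [S] using hy.snd_mem)
        (by simpa [S] using hz.snd_mem) hyz hy.adj_sub hz.adj_sub
      simpa [ec] using this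
    have h6 := Finset.sum_le_sum h5
    have h7 : ec (G.induce B) S S = ∑ x ∈ S, ∑ y ∈ S, if (G.induce B).Adj x y then 1 else 0 := rfl
    rw [← h7] at h6
    simp at h6
    omega

/-- A good set: the independent side of an extending partition. -/
def Good {V : Type*} (G : SimpleGraph V) (I F : Set V) (A : Set V) : Prop :=
  I ⊆ A ∧ (∀ x ∈ F, x ∉ A) ∧ TwoIndependent G A ∧
    ∀ X : Finset V, X.Nonempty → (∀ x ∈ X, x ∉ A) → ec G X X + 2 ≤ 2 * (X.card : ℤ)

lemma good_iff {V : Type*} [Fintype V] (G : SimpleGraph V) (I F : Set V) :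
    (∃ A B : Set V, IsIFPartition G A B ∧ I ⊆ A ∧ F ⊆ B) ↔ ∃ A, Good G I F A := by
  constructor
  · rintro ⟨A, B, ⟨h1, h2, h3, h4⟩, hI, hF⟩
    have hB : B = Aᶜ := (IsCompl.compl_eq ⟨h2, by rw [codisjoint_iff]; exact h1⟩).symm
    subst hB
    exact ⟨A, hI, fun x hx => hF hx, h3, fun X hX hA => (acyclic_iff G Aᶜ).mp h4 X hX hA⟩
  · rintro ⟨A, hI, hF, h3, h4⟩
    exact ⟨A, Aᶜ, ⟨by simp, disjoint_compl_right, h3, (acyclic_iff G Aᶜ).mpr h4⟩, hI, hF⟩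

lemma pot_map {V W : Type*} (G : SimpleGraph V) (I F : Set V) (f : W ↪ V) (X : Finset W) :
    pot G I F (X.map f) = pot (G.comap f) (f ⁻¹' I) (f ⁻¹' F) X := by
  unfold pot
  rw [ec_map, Finset.sum_map]
  rfl

/-- The minimality principle in terms of arbitrary finite vertex types. -/
lemma exists_good {V : Type*} [Fintype V] {G : SimpleGraph V} {I F U : Set V}
    (hmin : IsMinCounterexample G I F U) {W : Type*} [Fintype W] (G' : SimpleGraph W)
    (I' F' : Set W) (hd : ∀ x ∈ I', x ∉ F')
    (hp : ∀ X : Finset W, X.Nonempty → 0 < pot G' I' F' X)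
    (hlt : 2 * (Fintype.card W : ℤ) + ec G' Finset.univ Finset.univ <
      2 * (Fintype.card V : ℤ) + ec G Finset.univ Finset.univ) :
    ∃ A, Good G' I' F' A := by
  by_contra hno
  let e : W ≃ Fin (Fintype.card W) := Fintype.equivFin W
  let f : Fin (Fintype.card W) ↪ W := e.symm.toEmbedding
  have has : IsAssignment (f ⁻¹' I') (f ⁻¹' F') (f ⁻¹' (I' ∪ F')ᶜ) := by
    refine ⟨?_, ?_, ?_, ?_⟩
    · rw [← Set.preimage_union, ← Set.preimage_union, Set.union_compl_self, Set.preimage_univ]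
    · rw [Set.disjoint_left]; intro x hx; exact hd _ hx
    · rw [Set.disjoint_left]; intro x hx hx'; exact hx' (Or.inl hx)
    · rw [Set.disjoint_left]; intro x hx hx'; exact hx' (Or.inr hx)
  have hu : Finset.univ.map f = Finset.univ := by
    simp [f]
  have hc : IsCounterexample (G'.comap f) (f ⁻¹' I') (f ⁻¹' F') (f ⁻¹' (I' ∪ F')ᶜ) := by
    refine ⟨has, (pot_iff has).mpr fun X hX => ?_, ?_⟩
    · rw [← pot_map]; exact hp _ (by simpa using hX)
    · rw [good_iff]
      rintro ⟨A, h1, h2, h3, h4⟩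
      refine hno ⟨e ⁻¹' A, ?_, ?_, ?_, ?_⟩
      · intro x hx; exact h1 (by simpa [f] using hx)
      · intro x hx; exact h2 _ (by simpa [f] using hx)
      · intro x hx y hy hxy
        have := h3 _ hx _ hy (by simpa using hxy)
        simp only [comap_adj, f] at this
        refine ⟨by simpa using this.1, fun w hw => this.2 (e w) (by simpa using hw)⟩
      · intro X hX hA
        have h5 := h4 (X.map e.toEmbedding) (by simpa using hX)
          (by simp only [Finset.mem_map]; rintro _ ⟨y, hy, rfl⟩; exact hA y hy)
        rw [← ec_map, Finset.map_map] at h5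
        have : e.toEmbedding.trans f = Function.Embedding.refl _ := by ext; simp [f]
        simpa [this] using h5
  have := hmin.2 _ _ _ _ _ hc
  have h1 := ec_univ G
  have h2 := ec_univ (G'.comap f)
  rw [← ec_map, hu] at h2
  unfold edgeCount at this
  omega

/-- Minimality for proper induced subgraphs, with possibly changed assignment. -/
lemma exists_good_induce {V : Type*} [Fintype V] {G : SimpleGraph V} {I F U : Set V}
    (hmin : IsMinCounterexample G I F U) (T : Finset V) (hT : T ≠ Finset.univ)
    (I' F' : Set V) (hd : ∀ x ∈ I', x ∉ F')
    (hp : ∀ X : Finset V, X.Nonempty → X ⊆ T → 0 < pot G I' F' X) :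
    ∃ A : Set V, A ⊆ T ∧ (∀ x ∈ I', x ∈ T → x ∈ A) ∧ (∀ x ∈ F', x ∉ A) ∧
      (∀ x ∈ A, ∀ y ∈ A, x ≠ y → ¬ G.Adj x y ∧ ∀ z ∈ T, ¬ (G.Adj x z ∧ G.Adj z y)) ∧
      ∀ X : Finset V, X.Nonempty → X ⊆ T → (∀ x ∈ X, x ∉ A) → ec G X X + 2 ≤ 2 * (X.card : ℤ) := by
  let f : {x // x ∈ T} ↪ V := Function.Embedding.subtype _
  have hu : Finset.univ.map f = T := by ext; simp [f]
  have hcard : T.card < Fintype.card V := by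
    rw [← Finset.card_univ]
    exact Finset.card_lt_card (Finset.ssubset_univ_iff.mpr hT)
  obtain ⟨A, h1, h2, h3, h4⟩ := exists_good hmin (G.comap f) (f ⁻¹' I') (f ⁻¹' F')
    (fun x hx => hd _ hx) (fun X hX => by
      rw [← pot_map]
      exact hp _ (by simpa using hX) (by intro x; simp only [Finset.mem_map]; rintro ⟨y, _, rfl⟩; exact y.2))
    (by
      rw [← ec_map, hu]
      have := ec_mono G (Finset.subset_univ T) (Finset.subset_univ T)
      have h3 : Fintype.card {x // x ∈ T} = T.card := by simp
      rw [h3]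
      omega)
  refine ⟨f '' A, ?_, ?_, ?_, ?_, ?_⟩
  · rintro _ ⟨y, _, rfl⟩; exact y.2
  · intro x hx hxT; exact ⟨⟨x, hxT⟩, h1 hx, rfl⟩
  · rintro _ hx ⟨y, hy, rfl⟩; exact h2 y hx hy
  · rintro _ ⟨x, hx, rfl⟩ _ ⟨y, hy, rfl⟩ hxy
    have := h3 x hx y hy (fun h => hxy (by rw [h]))
    exact ⟨this.1, fun z hz => this.2 ⟨z, hz⟩⟩
  · intro X hX hXT hXA
    let Y : Finset {x // x ∈ T} := X.subtype (· ∈ T)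
    have hY : Y.map f = X := by
      ext x; simp [Y, f]; exact fun h => hXT h
    have := h4 Y (by rw [← Finset.map_nonempty (f := f), hY]; exact hX)
      (fun y hy hyA => hXA (f y) (by rw [← hY]; simpa using hy) ⟨y, hyA, rfl⟩)
    rw [← ec_map, hY] at this
    rwa [← hY, Finset.card_map, hY]

lemma wt_pos {V : Type*} (I F : Set V) (x : V) : 1 ≤ wt I F x := by
  unfold wt; split_ifs <;> norm_num

lemma wt_le {V : Type*} (I F : Set V) (x : V) : wt I F x ≤ 5 := by
  unfold wt; split_ifs <;> norm_num

lemma even_ec {V : Type*} [Fintype V] (G : SimpleGraph V) (X : Finset V) :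
    ∃ m : ℤ, ec G X X = 2 * m := by
  induction X using Finset.induction_on with
  | empty => exact ⟨0, by simp [ec]⟩
  | insert a s ha ih =>
    obtain ⟨m, hm⟩ := ih
    rw [Finset.insert_eq, ec_union G (by simpa using ha), hm, ec_single_self]
    exact ⟨m + ec G {a} s, by ring⟩

/-- the graph obtained by contracting `S` to an edge -/
def contr {V : Type*} (G : SimpleGraph V) (S : Finset V) (A : Set V) :
    SimpleGraph ({x // x ∉ S} ⊕ Bool) where
  Adj a b := match a, b with
    | .inl x, .inl y => G.Adj x y
    | .inl x, .inr b => ∃ y ∈ S, (y ∈ A ↔ b = true) ∧ G.Adj x y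
    | .inr b, .inl x => ∃ y ∈ S, (y ∈ A ↔ b = true) ∧ G.Adj x y
    | .inr b, .inr c => b ≠ c
  symm := ⟨by
    rintro (x | b) (y | c) h
    · exact G.adj_symm h
    · exact h
    · exact h
    · exact Ne.symm h⟩
  loopless := ⟨by
    rintro (x | b) h
    · exact G.loopless.irrefl _ h
    · exact h rfl⟩

noncomputable def qq {V : Type*} (G : SimpleGraph V) (S : Finset V) (A : Set V) (x : V)
    (b : Bool) : ℤ :=
  if ∃ y ∈ S, (y ∈ A ↔ b = true) ∧ G.Adj x y then 1 else 0

lemma qq_nonneg {V : Type*} (G : SimpleGraph V) (S : Finset V) (A : Set V) (x : V)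
    (b : Bool) : 0 ≤ qq G S A x b := by
  unfold qq; split_ifs <;> simp

lemma qq_sum {V : Type*} (G : SimpleGraph V) (S : Finset V) (A : Set V) (x : V) :
    qq G S A x true + qq G S A x false ≤ ec G {x} S := by
  have h0 := ec_nonneg G {x} S
  unfold qq
  split_ifs with h1 h2 h2
  · obtain ⟨y, hy, hyA, hxy⟩ := h1
    obtain ⟨z, hz, hzA, hxz⟩ := h2
    exact ec_two G hy hz (by rintro rfl; simp_all) hxy hxz
  · obtain ⟨y, hy, hyA, hxy⟩ := h1
    exact ec_one G hy hxy
  · obtain ⟨y, hy, hyA, hxy⟩ := h2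
    exact ec_one G hy hxy
  · simpa using h0

lemma ec_sum_left {V : Type*} (G : SimpleGraph V) (X S : Finset V) :
    ec G X S = ∑ x ∈ X, ec G {x} S := by
  simp only [ec, Finset.sum_singleton]

lemma ec_contr {V : Type*} (G : SimpleGraph V) (S : Finset V) (A : Set V)
    (Y : Finset {x // x ∉ S}) (R : Finset Bool) :
    ec (contr G S A) (Y.disjSum R) (Y.disjSum R) =
      ec G (Y.map (Function.Embedding.subtype _)) (Y.map (Function.Embedding.subtype _))
      + 2 * (∑ x ∈ Y.map (Function.Embedding.subtype _), ∑ b ∈ R, qq G S A x b)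
      + ∑ b ∈ R, ∑ c ∈ R, if b ≠ c then 1 else 0 := by
  have h1 : ∀ (x : {x // x ∉ S}) (b : Bool),
      (if (contr G S A).Adj (.inl x) (.inr b) then 1 else 0 : ℤ) = qq G S A x b := by
    intro x b; unfold qq; exact if_congr Iff.rfl rfl rfl
  have h2 : ∀ (x : {x // x ∉ S}) (b : Bool),
      (if (contr G S A).Adj (.inr b) (.inl x) then 1 else 0 : ℤ) = qq G S A x b := by
    intro x b; unfold qq; exact if_congr Iff.rfl rfl rfl
  have h3 : ∀ (x y : {x // x ∉ S}),
      (if (contr G S A).Adj (.inl x) (.inl y) then 1 else 0 : ℤ) =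
        if G.Adj x y then 1 else 0 := by
    intro x b; rfl
  have h4 : ∀ (b c : Bool),
      (if (contr G S A).Adj (.inr b) (.inr c) then 1 else 0 : ℤ) =
        if b ≠ c then 1 else 0 := by
    intro b c
    have : (contr G S A).Adj (.inr b) (.inr c) ↔ b ≠ c := Iff.rfl
    simp only [this]
  rw [ec_map]
  unfold ec
  simp only [Finset.sum_disjSum, h1, h2, h3, h4, Finset.sum_add_distrib, Finset.sum_map,
    comap_adj, Function.Embedding.subtype_apply]
  rw [Finset.sum_comm (s := R) (t := Y)]
  ring

lemma bool_cases : ∀ R : Finset Bool, R = ∅ ∨ R = {true} ∨ R = {false} ∨ R = {true, false} := by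
  decide

def cI {V : Type*} (S : Finset V) (I : Set V) : Set ({x // x ∉ S} ⊕ Bool) :=
  {a | Sum.elim (fun x => x.1 ∈ I) (fun b => b = true) a}

def cF {V : Type*} (S : Finset V) (F : Set V) : Set ({x // x ∉ S} ⊕ Bool) :=
  {a | Sum.elim (fun x => x.1 ∈ F) (fun b => b = false) a}

lemma pot_contr {V : Type*} (G : SimpleGraph V) (I F : Set V) (S : Finset V) (A : Set V)
    (Y : Finset {x // x ∉ S}) (R : Finset Bool) :
    pot (contr G S A) (cI S I) (cF S F) (Y.disjSum R) =
      pot G I F (Y.map (Function.Embedding.subtype _)) + 2 * (∑ b ∈ R, if b = true then 1 else 4)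
      - 8 * (∑ x ∈ Y.map (Function.Embedding.subtype _), ∑ b ∈ R, qq G S A x b)
      - 4 * ∑ b ∈ R, ∑ c ∈ R, if b ≠ c then 1 else 0 := by
  unfold pot
  rw [ec_contr, Finset.sum_disjSum]
  have h1 : ∀ x : {x // x ∉ S}, wt (cI S I) (cF S F) (.inl x) = wt I F x := by
    intro x; rfl
  have h2 : ∀ b : Bool, wt (cI S I) (cF S F) (.inr b : {x // x ∉ S} ⊕ Bool) = if b = true then 1 else 4 := by
    intro b
    cases b <;> simp [wt, cI, cF]
  simp only [h1, h2, Finset.sum_map, Function.Embedding.subtype_apply]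
  ring

/-- Gap lemma. -/
lemma gap {V : Type*} [Fintype V] {G : SimpleGraph V} {I F U : Set V}
    (hmin : IsMinCounterexample G I F U) (S : Finset V) (hS : S ≠ Finset.univ)
    {u : V} (huS : u ∈ S) (hu : u ∈ U) : 4 ≤ pot G I F S := by
  have has := hmin.1.1
  have hpot := (pot_iff has).mp hmin.1.2.1
  have hng := hmin.1.2.2
  rw [good_iff] at hng
  have hd : ∀ x ∈ I, x ∉ F := fun x h1 h2 => Set.disjoint_left.mp has.2.1 h1 h2
  have hSne : S.Nonempty := ⟨u, huS⟩
  by_contra hlt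
  have h2 : pot G I F S = 2 := by
    have := hpot S hSne
    unfold pot at this hlt ⊢
    omega
  obtain ⟨A, hAS, hIA, hFA, hAA, hAc⟩ := exists_good_induce hmin S hS I F hd
    (fun X hX _ => hpot X hX)
  have hone : ∀ x, x ∉ S → ec G {x} S ≤ 1 := by
    intro x hx
    have h1 := hpot (insert x S) (by simp)
    rw [pot_insert G I F hx] at h1
    have := wt_le I F x
    omega
  have hun : ∀ Y : Finset {x // x ∉ S},
      0 < pot G I F (Y.map (Function.Embedding.subtype _)) + 2
        - 8 * ec G (Y.map (Function.Embedding.subtype _)) S := by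
    intro Y
    have hdis : Disjoint (Y.map (Function.Embedding.subtype _)) S := by
      rw [Finset.disjoint_left]
      simp only [Finset.mem_map]
      rintro _ ⟨y, _, rfl⟩
      exact y.2
    have := hpot (Y.map (Function.Embedding.subtype _) ∪ S) (hSne.mono Finset.subset_union_right)
    rwa [pot_union G I F hdis, h2] at this
  have hqs : ∀ X : Finset V, (∑ x ∈ X, (qq G S A x true + qq G S A x false)) ≤ ec G X S := by
    intro X
    rw [ec_sum_left]
    exact Finset.sum_le_sum fun x _ => qq_sum G S A x
  have hq0 : ∀ (X : Finset V) b, 0 ≤ ∑ x ∈ X, qq G S A x b := fun X b =>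
    Finset.sum_nonneg fun x _ => qq_nonneg G S A x b
  have hdec : ∀ X : Finset ({x // x ∉ S} ⊕ Bool), ∃ Y R, X = Finset.disjSum Y R := fun X =>
    ⟨X.toLeft, X.toRight, Finset.toLeft_disjSum_toRight.symm⟩
  have hpc : ∀ X : Finset ({x // x ∉ S} ⊕ Bool), X.Nonempty →
      0 < pot (contr G S A) (cI S I) (cF S F) X := by
    intro X hX
    obtain ⟨Y, R, rfl⟩ := hdec X
    rw [pot_contr]
    have e1 := hun Y
    have e2 := hqs (Y.map (Function.Embedding.subtype _))
    have e3 := hq0 (Y.map (Function.Embedding.subtype _)) true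
    have e4 := hq0 (Y.map (Function.Embedding.subtype _)) false
    rw [Finset.sum_add_distrib] at e2
    rcases bool_cases R with rfl | rfl | rfl | rfl
    · have := hpot (Y.map (Function.Embedding.subtype _)) (by simpa using hX)
      simpa using this
    · simp only [Finset.sum_singleton, if_true, ne_eq, not_true, if_false]
      linarith
    · simp only [Finset.sum_singleton, if_true, ne_eq, not_true, if_false, Bool.false_eq_true]
      linarith
    · simp only [Finset.sum_pair (show true ≠ false by decide), if_true, ne_eq, not_true, if_false,
        Bool.false_eq_true, Finset.sum_add_distrib, not_false_eq_true, reduceCtorEq]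
      linarith
  have hsize : 2 * (Fintype.card ({x // x ∉ S} ⊕ Bool) : ℤ)
      + ec (contr G S A) Finset.univ Finset.univ <
      2 * (Fintype.card V : ℤ) + ec G Finset.univ Finset.univ := by
    have e0 : (Finset.univ : Finset ({x // x ∉ S} ⊕ Bool)) =
      Finset.disjSum Finset.univ {true, false} := by ext (x | b) <;> simp
    have e1 : (Finset.univ : Finset {x // x ∉ S}).map (Function.Embedding.subtype _)
      = Finset.univ \ S := by ext; simp
    have e2 : ec G Finset.univ Finset.univ = ec G (Finset.univ \ S) (Finset.univ \ S) + ec G S S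
        + 2 * ec G (Finset.univ \ S) S := by
      rw [← ec_union G Finset.sdiff_disjoint, Finset.sdiff_union_of_subset (Finset.subset_univ S)]
    rw [e0, ec_contr, e1, e2]
    have e3 := hqs (Finset.univ \ S)
    have e4 : Fintype.card ({x // x ∉ S} ⊕ Bool) + S.card = Fintype.card V + 2 := by
      have : Fintype.card {x // x ∉ S} + S.card = Fintype.card V := by
        rw [← Fintype.card_coe S, add_comm]
        have := Fintype.card_subtype_compl (fun x => x ∈ S)
        have h4 := Fintype.card_subtype_le (fun x => x ∈ S)
        omega
      simp only [Fintype.card_sum, Fintype.card_bool]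
      omega
    rw [Finset.sum_add_distrib] at e3
    simp only [Finset.sum_pair (show true ≠ false by decide), if_true, ne_eq, not_true, if_false,
        Bool.false_eq_true, Finset.sum_add_distrib, not_false_eq_true, reduceCtorEq]
    obtain ⟨m, hm⟩ := even_ec G S
    have hm0 := ec_nonneg G S S
    have hw : ∑ x ∈ S, wt I F x = 1 + 4 * m := by
      unfold pot at h2; omega
    have hwu : wt I F u = 5 := by
      have a1 : u ∉ I := fun h => Set.disjoint_left.mp has.2.2.1 h hu
      have a2 : u ∉ F := fun h => Set.disjoint_left.mp has.2.2.2 h hu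
      simp [wt, a1, a2]
    have hw2 : (S.card : ℤ) + 4 ≤ ∑ x ∈ S, wt I F x := by
      rw [← Finset.add_sum_erase S _ huS, hwu]
      have : ∑ x ∈ S.erase u, (1 : ℤ) ≤ ∑ x ∈ S.erase u, wt I F x :=
        Finset.sum_le_sum fun x _ => wt_pos I F x
      have h5 := Finset.card_erase_add_one huS
      simp at this
      omega
    have hc1 : S.card = 1 → m = 0 := by
      intro h
      obtain ⟨a, rfl⟩ := Finset.card_eq_one.mp h
      rw [ec_single_self] at hm
      omega
    have hc0 : 0 < S.card := Finset.card_pos.mpr hSne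
    have : (4 : ℤ) ≤ S.card + m := by
      by_contra hcon
      have : S.card = 1 ∨ 2 ≤ S.card := by omega
      rcases this with h | h
      · have := hc1 h
        omega
      · omega
    omega
  obtain ⟨A', hI', hF', hT', hC'⟩ := exists_good hmin (contr G S A) (cI S I) (cF S F)
    (by
      rintro (x | b)
      · exact hd x.1
      · simp [cI, cF]) hpc hsize
  have htA : (.inr true : {x // x ∉ S} ⊕ Bool) ∈ A' := hI' (by simp [cI])
  have hfA : (.inr false : {x // x ∉ S} ⊕ Bool) ∉ A' := hF' _ (by simp [cF])
  have hout : ∀ (x : V) (hx : x ∉ S), (.inl ⟨x, hx⟩ : {x // x ∉ S} ⊕ Bool) ∈ A' →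
      ∀ y ∈ S, ¬ G.Adj x y := by
    intro x hx hxA y hy hxy
    have h := hT' _ hxA _ htA (by simp)
    by_cases hyA : y ∈ A
    · exact h.1 ⟨y, hy, by simpa using hyA, hxy⟩
    · exact h.2 (.inr false) ⟨⟨y, hy, by simpa using hyA, hxy⟩, fun h => by cases h⟩
  have hout2 : ∀ (x : V) (hx : x ∉ S), (.inl ⟨x, hx⟩ : {x // x ∉ S} ⊕ Bool) ∈ A' →
      ∀ y ∈ A, ∀ z, ¬ (G.Adj x z ∧ G.Adj z y) := by
    rintro x hx hxA y hy z ⟨hxz, hzy⟩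
    by_cases hz : z ∈ S
    · exact hout x hx hxA z hz hxz
    · have h := hT' _ hxA _ htA (by simp)
      exact h.2 (.inl ⟨z, hz⟩) ⟨hxz, ⟨y, hAS hy, by simpa using hy, hzy⟩⟩
  let B : Set V := A ∪ {x | ∃ h : x ∉ S, (.inl ⟨x, h⟩ : {x // x ∉ S} ⊕ Bool) ∈ A'}
  refine hng ⟨B, ?_, ?_, ?_, ?_⟩
  · intro x hx
    by_cases hxS : x ∈ S
    · exact Or.inl (hIA x hx hxS)
    · exact Or.inr ⟨hxS, hI' (by simpa [cI] using hx)⟩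
  · rintro x hx (hxA | ⟨hxS, hxA⟩)
    · exact hFA x hx hxA
    · exact hF' _ (by simpa [cF] using hx) hxA
  · rintro x (hx | ⟨hxS, hx⟩) y (hy | ⟨hyS, hy⟩) hxy
    · have h := hAA x hx y hy hxy
      refine ⟨h.1, fun w hw => ?_⟩
      by_cases hwS : w ∈ S
      · exact h.2 w hwS hw
      · have h1 := hone w hwS
        have h2 := ec_two G (hAS hx) (hAS hy) hxy hw.1.symm hw.2
        omega
    · exact ⟨fun h => hout y hyS hy x (hAS hx) h.symm,
        fun w hw => hout2 y hyS hy x hx w ⟨hw.2.symm, hw.1.symm⟩⟩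
    · exact ⟨fun h => hout x hxS hx y (hAS hy) h,
        fun w hw => hout2 x hxS hx y hy w hw⟩
    · have h := hT' _ hx _ hy (by simpa using hxy)
      refine ⟨h.1, fun w hw => ?_⟩
      by_cases hwS : w ∈ S
      · exact hout x hxS hx w hwS hw.1
      · exact h.2 (.inl ⟨w, hwS⟩) hw
  · intro X hX hXB
    let Y : Finset {x // x ∉ S} := X.subtype (· ∉ S)
    have hY : Y.map (Function.Embedding.subtype _) = X \ S := by
      ext x; simp [Y]
    have hYc : (Y.card : ℤ) = (X \ S).card := by rw [← hY, Finset.card_map]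
    have hYA : ∀ y ∈ Y, (.inl y : {x // x ∉ S} ⊕ Bool) ∉ A' := by
      intro y hy hyA
      exact hXB y (by simpa [Y] using hy) (Or.inr ⟨y.2, hyA⟩)
    have hsplit : X = (X \ S) ∪ (X ∩ S) := (Finset.sdiff_union_inter X S).symm
    have hdis : Disjoint (X \ S) (X ∩ S) := Finset.disjoint_sdiff_inter X S
    by_cases hXS : (X ∩ S).Nonempty
    · have h1 := hAc (X ∩ S) hXS Finset.inter_subset_right
        (fun x hx hxA => hXB x (Finset.mem_inter.mp hx).1 (Or.inl hxA))
      have h3 := hC' (Y.disjSum {false}) ⟨.inr false, by simp⟩ (by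
        rintro (y | b) hy
        · exact hYA y (by simpa using hy)
        · have : b = false := by simpa using hy
          rw [this]; exact hfA)
      rw [ec_contr, hY] at h3
      simp only [Finset.sum_singleton, ne_eq, not_true, if_false, Finset.card_disjSum,
        Finset.card_singleton] at h3
      have h4 : ec G (X \ S) (X ∩ S) ≤ ∑ x ∈ X \ S, qq G S A x false := by
        rw [ec_sum_left]
        refine Finset.sum_le_sum fun x hx => ?_
        have a1 : ec G {x} (X ∩ S) ≤ ec G {x} S := ec_mono G subset_rfl Finset.inter_subset_right
        have a2 := hone x (Finset.mem_sdiff.mp hx).2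
        by_cases hq : ∃ y ∈ S, (y ∈ A ↔ false = true) ∧ G.Adj x y
        · have : qq G S A x false = 1 := if_pos hq
          omega
        · have hq1 : qq G S A x false = 0 := if_neg hq
          have : ec G {x} (X ∩ S) = 0 := by
            simp only [ec, Finset.sum_singleton]
            refine Finset.sum_eq_zero fun y hy => ?_
            rw [if_neg]
            intro hxy
            have hy' := Finset.mem_inter.mp hy
            exact hq ⟨y, hy'.2, by simpa using fun h => hXB y hy'.1 (Or.inl h), hxy⟩
          omega
      have h5 := ec_union G hdis
      have h6 := Finset.card_union_of_disjoint hdis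
      rw [← hsplit] at h5 h6
      push_cast at h3
      omega
    · have hXS' : X \ S = X := by
        rw [Finset.not_nonempty_iff_eq_empty] at hXS
        rw [hXS] at hsplit
        simpa using hsplit.symm
      rw [hXS'] at hY hYc
      have h3 := hC' (Y.disjSum ∅) (by
        rw [← hY, Finset.map_nonempty] at hX
        obtain ⟨y, hy⟩ := hX
        exact ⟨.inl y, by simpa using hy⟩) (by
        rintro (y | b) hy
        · exact hYA y (by simpa using hy)
        · simp at hy)
      rw [ec_contr, hY] at h3
      simp at h3
      omega

lemma ec_le_one {V : Type*} (G : SimpleGraph V) {u w : V} (X : Finset V)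
    (h : ∀ y ∈ X, G.Adj u y → y = w) : ec G {u} X ≤ 1 := by
  simp only [ec, Finset.sum_singleton]
  calc _ ≤ ∑ y ∈ X, (if y = w then 1 else 0 : ℤ) := Finset.sum_le_sum fun y hy => by
        by_cases hy' : G.Adj u y
        · rw [if_pos hy', if_pos (h y hy hy')]
        · simp only [hy', if_false]; split_ifs <;> simp
    _ ≤ 1 := by
        rw [Finset.sum_ite_eq']
        split_ifs <;> simp

lemma wt_change {V : Type*} (I F U Ws : Set V) (x : V) (b1 : x ∈ I → x ∉ F) (b2 : x ∈ I → x ∉ U)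
    (b3 : x ∈ F → x ∉ U) (b4 : x ∈ Ws → x ∈ F ∪ U) :
    wt I (F ∪ Ws) x = wt I F x - if x ∈ Ws ∧ x ∈ U then 1 else 0 := by
  unfold wt
  simp only [Set.mem_union] at b4 ⊢
  by_cases c1 : x ∈ I <;> by_cases c2 : x ∈ F <;> by_cases c3 : x ∈ Ws <;>
    by_cases c4 : x ∈ U <;> simp_all

end IFP

set_option maxHeartbeats 1000000

/-- Claim 3.8: a minimal counterexample contains no 3-vertex in `U` incident to three
1-threads all of whose bordering vertices lie in `F ∪ U`. -/
theorem no_three_vertex_with_three_one_threads {V : Type*} [Fintype V] (G : SimpleGraph V)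
    (I F U : Set V) (hmin : IsMinCounterexample G I F U) :
    ¬ ∃ v ∈ U, deg G v = 3 ∧
      ∀ u, G.Adj v u → ∃ p : List V, IsThread G I F U p ∧ p.length = 1 ∧ u ∈ p ∧ v ∉ p ∧
        ∀ w, BordersThread G p w → w ∈ F ∪ U := by

  classical
  rintro ⟨v, hvU, hdeg, hthr⟩
  have has := hmin.1.1
  have hpot := (IFP.pot_iff has).mp hmin.1.2.1
  have hng := hmin.1.2.2
  rw [IFP.good_iff] at hng
  have hIF : ∀ x ∈ I, x ∉ F := fun x h1 h2 => Set.disjoint_left.mp has.2.1 h1 h2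
  have hIU : ∀ x ∈ I, x ∉ U := fun x h1 h2 => Set.disjoint_left.mp has.2.2.1 h1 h2
  have hFU : ∀ x ∈ F, x ∉ U := fun x h1 h2 => Set.disjoint_left.mp has.2.2.2 h1 h2
  have hwt : ∀ x ∈ U, IFP.wt I F x = 5 := by
    intro x hx
    have a1 : x ∉ I := fun h => hIU x h hx
    have a2 : x ∉ F := fun h => hFU x h hx
    simp [IFP.wt, a1, a2]
  have hN0 : ∀ u, G.Adj v u → u ∈ U ∧ deg G u = 2 ∧
      (∀ w, w ≠ u → G.Adj u w → (3 ≤ deg G w ∨ w ∈ I ∪ F) ∧ w ∈ F ∪ U) := by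
    intro u hu
    obtain ⟨p, ⟨_, _, _, h4, h5⟩, hl, hup, _, hb⟩ := hthr u hu
    obtain ⟨a, rfl⟩ := List.length_eq_one_iff.mp hl
    have : u = a := by simpa using hup
    subst this
    refine ⟨(h4 u (by simp)).1, (h4 u (by simp)).2, fun w hw huw => ⟨?_, ?_⟩⟩
    · exact h5 w (by simpa using hw) ⟨u, by simp, huw⟩
    · exact hb w ⟨by simpa using hw, u, by simp, huw⟩
  have hN : ∀ u, G.Adj v u → u ∈ U ∧ ∃ w, w ≠ v ∧ w ∈ F ∪ U ∧
      (∀ y, G.Adj u y ↔ y = v ∨ y = w) ∧ ¬ G.Adj v w := by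
    intro u hu
    obtain ⟨h1, h2, h3⟩ := hN0 u hu
    refine ⟨h1, ?_⟩
    have h4 : (G.neighborSet u).ncard = 2 := h2
    obtain ⟨a, b, hab, he⟩ := Set.ncard_eq_two.mp h4
    have hadj : ∀ y, G.Adj u y ↔ y = a ∨ y = b := by
      intro y
      rw [← mem_neighborSet, he]; simp
    have key : ∀ w, G.Adj u w → w ∈ F ∪ U ∧ ¬ (G.Adj v w) := by
      intro w hw
      have h5 := h3 w hw.ne' hw
      refine ⟨h5.2, fun hvw => ?_⟩
      obtain ⟨h6, h7, _⟩ := hN0 w hvw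
      rcases h5.1 with h | h | h
      · omega
      · exact hIU w h h6
      · exact hFU w h h6
    rcases (hadj v).mp hu.symm with rfl | rfl
    · exact ⟨b, hab.symm, (key b ((hadj b).mpr (Or.inr rfl))).1, hadj,
        (key b ((hadj b).mpr (Or.inr rfl))).2⟩
    · exact ⟨a, hab, (key a ((hadj a).mpr (Or.inl rfl))).1, fun y => by rw [hadj y, or_comm],
        (key a ((hadj a).mpr (Or.inl rfl))).2⟩
  have h3 : (G.neighborSet v).ncard = 3 := hdeg
  obtain ⟨u1, u2, u3, h12, h13, h23, he⟩ := Set.ncard_eq_three.mp h3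
  have hv : ∀ y, G.Adj v y ↔ y = u1 ∨ y = u2 ∨ y = u3 := by
    intro y
    rw [← mem_neighborSet, he]; simp
  have a1 := (hv u1).mpr (by simp)
  have a2 := (hv u2).mpr (by simp)
  have a3 := (hv u3).mpr (by simp)
  obtain ⟨hu1, w1, w1v, w1FU, w1N, w1n⟩ := hN u1 a1
  obtain ⟨hu2, w2, w2v, w2FU, w2N, w2n⟩ := hN u2 a2
  obtain ⟨hu3, w3, w3v, w3FU, w3N, w3n⟩ := hN u3 a3
  have v1 := a1.ne
  have v2 := a2.ne
  have v3 := a3.ne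
  let T : Finset V := Finset.univ \ {v, u1, u2, u3}
  have hTmem : ∀ x, x ∈ T ↔ x ≠ v ∧ ¬ G.Adj v x := by
    intro x; simp [T, hv]
  let Ws : Finset V := {w1, w2, w3}
  have hWs : ∀ x, x ∈ Ws ↔ x = w1 ∨ x = w2 ∨ x = w3 := by intro x; simp [Ws]
  have hWex : ∀ x ∈ Ws, ∃ u, G.Adj v u ∧ ∀ y, G.Adj u y ↔ y = v ∨ y = x := by
    intro x hx
    rcases (hWs x).mp hx with rfl | rfl | rfl
    · exact ⟨u1, a1, w1N⟩
    · exact ⟨u2, a2, w2N⟩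
    · exact ⟨u3, a3, w3N⟩
  have hWFU : ∀ x ∈ Ws, x ∈ F ∪ U := by
    intro x hx
    rcases (hWs x).mp hx with rfl | rfl | rfl <;> assumption
  have hWT : ∀ x ∈ Ws, x ≠ v := by
    intro x hx
    rcases (hWs x).mp hx with rfl | rfl | rfl <;> assumption
  let F' : Set V := F ∪ Ws
  have hTu : ∀ X : Finset V, X ⊆ T → X ≠ Finset.univ := by
    intro X hX h
    have : v ∈ X := by rw [h]; simp
    exact ((hTmem v).mp (hX this)).1 rfl
  have hpair : ∀ X : Finset V, X ⊆ T → ∀ a ∈ Ws, ∀ b ∈ Ws, a ≠ b → a ∈ X → b ∈ X →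
      6 ≤ IFP.pot G I F X := by
    intro X hXT a haW b hbW hab ha hb
    obtain ⟨u, hvu, hua⟩ := hWex a haW
    obtain ⟨u', hvu', hub⟩ := hWex b hbW
    have huu : u ≠ u' := by
      rintro rfl
      have := (hub a).mp ((hua a).mpr (Or.inr rfl))
      have := hWT a haW
      tauto
    have nX : ∀ y, G.Adj v y → y ∉ X := fun y hy hyX => ((hTmem y).mp (hXT hyX)).2 hy
    have vX : v ∉ X := fun hyX => ((hTmem v).mp (hXT hyX)).1 rfl
    have hne : insert v (insert u (insert u' X)) ≠ Finset.univ := by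
      intro h
      have hall : ∀ y, G.Adj v y → y = u ∨ y = u' := by
        intro y hy
        have hy2 : y ∈ insert v (insert u (insert u' X)) := by rw [h]; simp
        simp only [Finset.mem_insert] at hy2
        have := nX y hy
        have := hy.ne'
        tauto
      have := hall _ a1
      have := hall _ a2
      have := hall _ a3
      grind
    have hg := IFP.gap hmin _ hne (u := v) (by simp) hvU
    rw [IFP.pot_insert G I F (by simp [vX, hvu.ne, hvu'.ne]),
      IFP.pot_insert G I F (by simp [huu, nX u hvu]),
      IFP.pot_insert G I F (nX u' hvu'), hwt _ hvU, hwt _ (hN u hvu).1, hwt _ (hN u' hvu').1] at hg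
    have e1 := IFP.ec_two G (X := insert u (insert u' X)) (by simp) (by simp) huu hvu hvu'
    have e2 := IFP.ec_one G (X := insert u' X) (by simp [ha]) ((hua a).mpr (Or.inr rfl))
    have e3 := IFP.ec_one G hb ((hub b).mpr (Or.inr rfl))
    omega
  have hpot' : ∀ X : Finset V, X.Nonempty → X ⊆ T → 0 < IFP.pot G I F' X := by
    intro X hX hXT
    let C : Finset V := X.filter (fun x => x ∈ Ws ∧ x ∈ U)
    have hpe : IFP.pot G I F' X = IFP.pot G I F X - 2 * (C.card : ℤ) := by
      have : ∑ x ∈ X, IFP.wt I F' x = ∑ x ∈ X, IFP.wt I F x - (C.card : ℤ) := by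
        have hC : (C.card : ℤ) = ∑ x ∈ X, if x ∈ Ws ∧ x ∈ U then 1 else 0 := by simp [C]
        rw [hC, ← Finset.sum_sub_distrib]
        refine Finset.sum_congr rfl fun x _ => ?_
        have := IFP.wt_change I F U Ws x (hIF x) (hIU x) (hFU x) (hWFU x)
        convert this
        exact Iff.rfl
      unfold IFP.pot
      rw [this]; ring
    rw [hpe]
    have hCW : C ⊆ Ws := fun x hx => ((Finset.mem_filter.mp hx).2).1
    have hCX : C ⊆ X := Finset.filter_subset _ _
    have hWc : Ws.card ≤ 3 := Finset.card_le_three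
    have hCc := Finset.card_le_card hCW
    have hp0 := hpot X hX
    have hcase : C.card = 0 ∨ C.card = 1 ∨ C.card = 2 ∨ C.card = 3 := by omega
    rcases hcase with h | h | h | h
    · rw [h]; simpa using hp0
    · obtain ⟨x, hx⟩ := Finset.card_eq_one.mp h
      have hxC : x ∈ C := by rw [hx]; simp
      have := IFP.gap hmin X (hTu X hXT) (hCX hxC) (Finset.mem_filter.mp hxC).2.2
      rw [h]; push_cast; omega
    · obtain ⟨x, y, hxy, hC⟩ := Finset.card_eq_two.mp h
      have hxC : x ∈ C := by rw [hC]; simp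
      have hyC : y ∈ C := by rw [hC]; simp
      have := hpair X hXT x (hCW hxC) y (hCW hyC) hxy (hCX hxC) (hCX hyC)
      rw [h]; push_cast; omega
    · have hCWe : C = Ws := Finset.eq_of_subset_of_card_le hCW (by omega)
      have x1 : w1 ∈ X := hCX (by rw [hCWe]; simp [Ws])
      have x2 : w2 ∈ X := hCX (by rw [hCWe]; simp [Ws])
      have x3 : w3 ∈ X := hCX (by rw [hCWe]; simp [Ws])
      have nX : ∀ y, G.Adj v y → y ∉ X := fun y hy hyX => ((hTmem y).mp (hXT hyX)).2 hy
      have vX : v ∉ X := fun hyX => ((hTmem v).mp (hXT hyX)).1 rfl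
      have hg := hpot (insert v (insert u1 (insert u2 (insert u3 X)))) (by simp)
      rw [IFP.pot_insert G I F (by simp [vX, v1, v2, v3]),
        IFP.pot_insert G I F (by simp [h12, h13, nX u1 a1]),
        IFP.pot_insert G I F (by simp [h23, nX u2 a2]),
        IFP.pot_insert G I F (nX u3 a3), hwt _ hvU, hwt _ hu1, hwt _ hu2, hwt _ hu3] at hg
      have e1 := IFP.ec_three G (X := insert u1 (insert u2 (insert u3 X))) (by simp) (by simp)
        (by simp) h12 h13 h23 a1 a2 a3
      have e2 := IFP.ec_one G (X := insert u2 (insert u3 X)) (by simp [x1])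
        ((w1N w1).mpr (Or.inr rfl))
      have e3 := IFP.ec_one G (X := insert u3 X) (by simp [x2]) ((w2N w2).mpr (Or.inr rfl))
      have e4 := IFP.ec_one G x3 ((w3N w3).mpr (Or.inr rfl))
      rw [h]; push_cast; omega
  obtain ⟨A, hAT, hIA, hFA, hAA, hAc⟩ := IFP.exists_good_induce hmin T (hTu T subset_rfl) I F'
    (by
      rintro x hx (h | h)
      · exact hIF x hx h
      · rcases hWFU x h with h | h
        · exact hIF x hx h
        · exact hIU x hx h) hpot'
  have hAv : ∀ x ∈ A, x ≠ v ∧ ¬ G.Adj v x := fun x hx => (hTmem x).mp (hAT hx)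
  have hA2 : ∀ u, G.Adj v u → ∀ x ∈ A, ¬ G.Adj u x := by
    intro u hu x hx hux
    have hW : x ∈ Ws → False := fun h => hFA x (Or.inr h) hx
    have hxv := (hAv x hx).1
    rcases (hv u).mp hu with rfl | rfl | rfl
    · rcases (w1N x).mp hux with h | h
      · exact hxv h
      · exact hW (by simp [Ws, h])
    · rcases (w2N x).mp hux with h | h
      · exact hxv h
      · exact hW (by simp [Ws, h])
    · rcases (w3N x).mp hux with h | h
      · exact hxv h
      · exact hW (by simp [Ws, h])
  refine hng ⟨insert v A, ?_, ?_, ?_, ?_⟩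
  · intro x hx
    refine Or.inr (hIA x hx ((hTmem x).mpr ⟨?_, ?_⟩))
    · rintro rfl; exact hIU _ hx hvU
    · intro h; exact hIU _ hx (hN x h).1
  · rintro x hx (rfl | h)
    · exact hFU _ hx hvU
    · exact hFA x (Or.inl hx) h
  · rintro x (rfl | hx) y (rfl | hy) hxy
    · exact absurd rfl hxy
    · exact ⟨(hAv y hy).2, fun z hz => hA2 z hz.1 y hy hz.2⟩
    · exact ⟨fun h => (hAv x hx).2 h.symm, fun z hz => hA2 z hz.2.symm x hx hz.1.symm⟩
    · have h := hAA x hx y hy hxy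
      refine ⟨h.1, fun z hz => ?_⟩
      by_cases hzT : z ∈ T
      · exact h.2 z hzT hz
      · rw [hTmem] at hzT
        by_cases hzv : z = v
        · subst hzv
          exact (hAv y hy).2 hz.2
        · have : G.Adj v z := by tauto
          exact hA2 z this y hy hz.2
  · intro X
    induction X using Finset.strongInduction with
    | H X ih =>
      intro hX hXA
      have hvX : v ∉ X := fun h => hXA v h (Or.inl rfl)
      by_cases hu : ∃ u ∈ X, G.Adj v u
      · obtain ⟨u, huX, hvu⟩ := hu
        obtain ⟨_, w, _, _, hw, _⟩ := hN u hvu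
        have hle : IFP.ec G {u} (X.erase u) ≤ 1 := by
          refine IFP.ec_le_one G (w := w) _ fun y hy huy => ?_
          rcases (hw y).mp huy with rfl | h
          · exact absurd (Finset.mem_of_mem_erase hy) hvX
          · exact h
        have hun := IFP.ec_union G (X := {u}) (Y := X.erase u) (by simp)
        rw [← Finset.insert_eq, Finset.insert_erase huX, IFP.ec_single_self] at hun
        have hc := Finset.card_erase_add_one huX
        by_cases hE : (X.erase u).Nonempty
        · have := ih (X.erase u) (Finset.erase_ssubset huX) hE
            (fun x hx => hXA x (Finset.mem_of_mem_erase hx))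
          omega
        · rw [Finset.not_nonempty_iff_eq_empty] at hE
          rw [hE] at hun hc
          simp [IFP.ec] at hun hc
          have : IFP.ec G X X = 0 := by simpa [IFP.ec] using hun
          omega
      · refine hAc X hX (fun x hx => (hTmem x).mpr ⟨?_, ?_⟩) (fun x hx h => hXA x hx (Or.inr h))
        · rintro rfl; exact hvX hx
        · intro h; exact hu ⟨x, hx, h⟩
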